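/- If 𝒞 ⊆ 𝒫(X) is a finite-set-trace d-maximum set system with ladder dimension at most n and ∅ ∈ 𝒞, then every member of 𝒞 has cardinality at most n. -/

import Mathlib

open Set

variable {α : Type*}

/-- The trace of a set system on a set `A`. -/
def trace (𝒞 : Set (Set α)) (A : Set α) : Set (Set α) := {s | ∃ C ∈ 𝒞, s = C ∩ A}

/-- `∑_{i=0}^{d} (n choose i)`. -/
def binLe (n d : ℕ) : ℕ := ∑ i ∈ Finset.range (d + 1), n.choose i

/-- `𝒞` shatters `A`. -/
def shatters (𝒞 : Set (Set α)) (A : Set α) : Prop := ∀ B ⊆ A, ∃ C ∈ 𝒞, C ∩ A = B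

/-- `𝒞` is a `d`-maximum set system. -/
def isMaximum (𝒞 : Set (Set α)) (d : ℕ) : Prop :=
  ∀ A : Set α, A.Finite → (trace 𝒞 A).ncard = binLe A.ncard d

/-- There is a ladder of length `n` for `𝒞`. -/
def hasLadder (𝒞 : Set (Set α)) (n : ℕ) : Prop :=
  ∃ (x : Fin n → α) (B : Fin n → Set α), (∀ j, B j ∈ 𝒞) ∧ ∀ i j, x i ∈ B j ↔ i < j

/-- `∑_{i<k} (n choose i)`. -/
def bn (n k : ℕ) : ℕ := ∑ i ∈ Finset.range k, n.choose i

theorem bn_succ (n k : ℕ) : bn (n+1) (k+1) = bn n (k+1) + bn n k := by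
  induction k with
  | zero => simp [bn]
  | succ k ih =>
    have h1 : bn (n+1) (k+1+1) = bn (n+1) (k+1) + (n+1).choose (k+1) := Finset.sum_range_succ _ _
    have h2 : bn n (k+1+1) = bn n (k+1) + n.choose (k+1) := Finset.sum_range_succ _ _
    have h3 : bn n (k+1) = bn n k + n.choose k := Finset.sum_range_succ _ _
    have := Nat.choose_succ_succ n k
    simp only [Nat.succ_eq_add_one] at this
    omega

theorem sauer_bn [DecidableEq α] (F : Finset (Finset α)) (A : Finset α) (k : ℕ)
    (hA : ∀ S ∈ F, S ⊆ A) (hs : ∀ s, F.Shatters s → s.card < k) : F.card ≤ bn A.card k := by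
  refine (Finset.card_le_card_shatterer F).trans ?_
  have : F.shatterer ⊆ (Finset.range k).biUnion (fun i => A.powersetCard i) := by
    intro s h
    rw [Finset.mem_shatterer] at h
    simp only [Finset.mem_biUnion, Finset.mem_range, Finset.mem_powersetCard]
    refine ⟨_, hs s h, ?_, rfl⟩
    obtain ⟨u, hu, hsu⟩ := h (Finset.Subset.refl s)
    exact (Finset.inter_eq_left.1 hsu).trans (hA u hu)
  refine (Finset.card_le_card this).trans (Finset.card_biUnion_le.trans ?_)
  simp [bn]

structure Mx [DecidableEq α] (F : Finset (Finset α)) (A : Finset α) (k : ℕ) : Prop where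
  sub : ∀ S ∈ F, S ⊆ A
  card : F.card = bn A.card k
  vc : ∀ s, F.Shatters s → s.card < k

def tr [DecidableEq α] (z : α) (F : Finset (Finset α)) : Finset (Finset α) :=
  F.image (fun S => S.erase z)

def rd [DecidableEq α] (z : α) (F : Finset (Finset α)) : Finset (Finset α) :=
  F.filter (fun S => z ∉ S ∧ insert z S ∈ F)

def ins [DecidableEq α] (b : Bool) (z : α) (S : Finset α) : Finset α :=
  if b then insert z S else S

theorem mem_tr [DecidableEq α] {z : α} {F : Finset (Finset α)} {S : Finset α} :
    S ∈ tr z F ↔ z ∉ S ∧ ∃ b, ins b z S ∈ F := by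
  simp only [tr, Finset.mem_image, ins, Bool.exists_bool]
  constructor
  · rintro ⟨T, hT, rfl⟩
    refine ⟨by simp, ?_⟩
    by_cases h : z ∈ T
    · right; simpa [Finset.insert_erase h] using hT
    · left; simpa [Finset.erase_eq_of_notMem h] using hT
  · rintro ⟨hz, h | h⟩
    · exact ⟨S, by simpa using h, by simp [hz]⟩
    · exact ⟨insert z S, by simpa using h, by simp [hz]⟩

theorem mem_rd [DecidableEq α] {z : α} {F : Finset (Finset α)} {S : Finset α} :
    S ∈ rd z F ↔ z ∉ S ∧ ∀ b, ins b z S ∈ F := by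
  simp only [rd, Finset.mem_filter, ins, Bool.forall_bool]
  simp
  tauto

theorem card_tr_rd [DecidableEq α] (z : α) (F : Finset (Finset α)) :
    F.card = (tr z F).card + (rd z F).card := by
  have h1 : tr z F = F.memberSubfamily z ∪ F.nonMemberSubfamily z := by
    ext S
    simp only [mem_tr, Finset.mem_union, Finset.mem_memberSubfamily, Finset.mem_nonMemberSubfamily,
      Bool.exists_bool, ins]
    simp
    tauto
  have h2 : rd z F = F.memberSubfamily z ∩ F.nonMemberSubfamily z := by
    ext S
    simp only [mem_rd, Finset.mem_inter, Finset.mem_memberSubfamily, Finset.mem_nonMemberSubfamily,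
      Bool.forall_bool, ins]
    simp
    tauto
  rw [h1, h2, Finset.card_union_add_card_inter, Finset.card_memberSubfamily_add_card_nonMemberSubfamily]

theorem Mx.step [DecidableEq α] {F : Finset (Finset α)} {A : Finset α} {k : ℕ}
    (h : Mx F A (k+1)) {z : α} (hz : z ∈ A) :
    Mx (tr z F) (A.erase z) (k+1) ∧ Mx (rd z F) (A.erase z) k := by
  have t1 : ∀ S ∈ tr z F, S ⊆ A.erase z := by
    intro S hS
    obtain ⟨T, hT, rfl⟩ := Finset.mem_image.1 hS
    exact Finset.erase_subset_erase _ (h.sub T hT)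
  have r1 : ∀ S ∈ rd z F, S ⊆ A.erase z := by
    intro S hS
    obtain ⟨hT, hzS, _⟩ := Finset.mem_filter.1 hS
    exact Finset.subset_erase.2 ⟨h.sub S hT, hzS⟩
  have t2 : ∀ s, (tr z F).Shatters s → s.card < k + 1 := by
    intro s hs
    apply h.vc
    obtain ⟨u, hu, hsu⟩ := hs (Finset.Subset.refl s)
    have hzs : z ∉ s := fun hh => (mem_tr.1 hu).1 (Finset.inter_eq_left.1 hsu hh)
    intro t ht
    obtain ⟨u, hu, hsu⟩ := hs ht
    obtain ⟨T, hT, rfl⟩ := Finset.mem_image.1 hu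
    refine ⟨T, hT, ?_⟩
    rw [← hsu]
    ext a
    simp only [Finset.mem_inter, Finset.mem_erase]
    grind
  have r2 : ∀ s, (rd z F).Shatters s → s.card < k := by
    intro s hs
    obtain ⟨u, hu, hsu⟩ := hs (Finset.Subset.refl s)
    have hzs : z ∉ s := fun hh => (mem_rd.1 hu).1 (Finset.inter_eq_left.1 hsu hh)
    have : F.Shatters (insert z s) := by
      intro t ht
      have : t.erase z ⊆ s := by grind
      obtain ⟨u, hu, hsu⟩ := hs this
      obtain ⟨hT, hzS, hi⟩ := Finset.mem_filter.1 hu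
      by_cases hzt : z ∈ t
      · refine ⟨_, hi, ?_⟩
        ext a
        have := congrArg (a ∈ ·) hsu
        grind
      · refine ⟨_, hT, ?_⟩
        ext a
        have := congrArg (a ∈ ·) hsu
        grind
    have := h.vc _ this
    rw [Finset.card_insert_of_notMem hzs] at this
    omega
  have c1 := sauer_bn _ _ _ t1 t2
  have c2 := sauer_bn _ _ _ r1 r2
  have c3 := card_tr_rd z F
  have c4 := h.card
  have c5 : A.card = (A.erase z).card + 1 := (Finset.card_erase_add_one hz).symm
  rw [c5, bn_succ] at c4
  exact ⟨⟨t1, by omega, t2⟩, ⟨r1, by omega, r2⟩⟩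

theorem Mx.rd_tr [DecidableEq α] {F : Finset (Finset α)} {A : Finset α} {k : ℕ}
    (h : Mx F A (k+1)) {z w : α} (hz : z ∈ A) (hw : w ∈ A) (hne : w ≠ z) :
    tr z (rd w F) = rd w (tr z F) := by
  apply Finset.eq_of_subset_of_card_le
  · intro S hS
    rw [mem_tr] at hS
    obtain ⟨hzS, b, hb⟩ := hS
    rw [mem_rd] at hb
    rw [mem_rd]
    refine ⟨by have := hb.1; cases b <;> simp_all [ins], fun c => ?_⟩
    rw [mem_tr]
    refine ⟨by cases c <;> simp [ins, hzS, hne.symm], b, ?_⟩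
    have := hb.2 c
    convert this using 1
    cases b <;> cases c <;> simp [ins, Finset.insert_comm]
  · have h1 := ((h.step hz).1.step (z := w) (by simp [hw, hne])).2.card
    cases k with
    | zero => 
      rw [h1]; simp [bn]
    | succ k =>
      have h2 := ((h.step hw).2.step (z := z) (by simp [hz, hne.symm])).1.card
      rw [h1, h2, Finset.erase_right_comm]

theorem Mx.edge [DecidableEq α] {F : Finset (Finset α)} {A : Finset α} {k : ℕ}
    (h : Mx F A (k+1)) {z w : α} (hz : z ∈ A) (hw : w ∈ A) (hne : w ≠ z) {S : Finset α}
    (h1 : S ∈ tr z F) (h2 : symmDiff S {w} ∈ tr z F) :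
    ∃ b, ins b z S ∈ F ∧ ins b z (symmDiff S {w}) ∈ F := by
  have hm : S.erase w ∈ rd w (tr z F) := by
    rw [mem_rd]
    refine ⟨by simp, ?_⟩
    have : ∀ b, ins b w (S.erase w) = S ∨ ins b w (S.erase w) = symmDiff S {w} := by
      intro b
      by_cases hs : w ∈ S <;> cases b
      · right; ext a; simp [ins, Finset.mem_symmDiff]; grind
      · left; ext a; simp [ins]; grind
      · left; ext a; simp [ins]; grind
      · right; ext a; simp [ins, Finset.mem_symmDiff]; grind
    intro b
    rcases this b with h | h <;> rw [h] <;> assumption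
  rw [← h.rd_tr hz hw hne, mem_tr] at hm
  obtain ⟨-, b, hb⟩ := hm
  rw [mem_rd] at hb
  refine ⟨b, ?_, ?_⟩
  · convert hb.2 (decide (w ∈ S)) using 1
    ext a
    by_cases hs : w ∈ S <;> cases b <;> simp [ins, hs] <;> grind
  · convert hb.2 (decide (w ∉ S)) using 1
    ext a
    by_cases hs : w ∈ S <;> cases b <;> simp [ins, hs, Finset.mem_symmDiff] <;> grind

theorem between_aux [DecidableEq α] {E D G : Finset α} {x : α} (hx : x ∈ symmDiff E D)
    (h : symmDiff (symmDiff E {x}) G ⊆ symmDiff (symmDiff E {x}) D) :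
    symmDiff E G ⊆ symmDiff E D ∧ x ∈ symmDiff E G := by
  constructor
  · intro a ha
    by_cases hax : a = x
    · rw [hax]; exact hx
    have := @h a
    simp only [Finset.mem_symmDiff, Finset.mem_singleton, hax] at *
    tauto
  · have := @h x
    simp only [Finset.mem_symmDiff, Finset.mem_singleton] at *
    tauto

theorem Mx.nbr [DecidableEq α] (m : ℕ) : ∀ {F : Finset (Finset α)} {A : Finset α} {k : ℕ}
    (_ : Mx F A k) (_ : A.card = m) {C D : Finset α} (_ : C ∈ F) (_ : D ∈ F) (_ : C ≠ D),
    ∃ x ∈ symmDiff C D, symmDiff C {x} ∈ F := by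
  induction m with
  | zero =>
    intro F A k h hA C D hC hD hne
    rw [Finset.card_eq_zero] at hA
    subst hA
    exact absurd ((Finset.subset_empty.1 (h.sub _ hC)).trans
      (Finset.subset_empty.1 (h.sub _ hD)).symm) hne
  | succ m ih =>
    intro F A k h hA C D hC hD hne
    cases k with
    | zero =>
      have := h.card
      simp [bn] at this
      simp [this] at hC
    | succ k =>
    by_cases hall : ∀ z ∈ A, z ∈ symmDiff C D
    · -- the antipodal case
      have hz : ∃ z, z ∈ A := by
        apply Finset.card_pos.1; omega
      obtain ⟨z, hz⟩ := hz
      have hzCD := hall z hz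
      by_cases heq : C.erase z = D.erase z
      · refine ⟨z, hzCD, ?_⟩
        convert hD using 1
        ext a
        have := congrArg (a ∈ ·) heq
        simp only [Finset.mem_symmDiff, Finset.mem_singleton, Finset.mem_erase] at *
        grind
      · obtain ⟨x, hx, hxF⟩ := ih (h.step hz).1 (by rw [Finset.card_erase_of_mem hz]; omega)
          (Finset.mem_image_of_mem _ hC) (Finset.mem_image_of_mem _ hD) heq
        have hxz : x ≠ z := by rintro rfl; simp [Finset.mem_symmDiff] at hx
        have hxCD : x ∈ symmDiff C D := by
          simp only [Finset.mem_symmDiff, Finset.mem_erase] at *; grind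
        have hxA : x ∈ A := by
          have := h.sub _ hC; have := h.sub _ hD
          simp only [Finset.mem_symmDiff] at hxCD; grind
        obtain ⟨b, hb1, hb2⟩ := h.edge hz hxA hxz (Finset.mem_image_of_mem _ hC) hxF
        by_cases hb : b = decide (z ∈ C)
        · refine ⟨x, hxCD, ?_⟩
          convert hb2 using 1
          subst hb
          ext a
          by_cases hs : z ∈ C <;> simp [ins, hs, Finset.mem_symmDiff] <;> grind
        · refine ⟨z, hzCD, ?_⟩
          convert hb1 using 1
          ext a
          by_cases hs : z ∈ C <;> cases b <;> simp [hs] at hb <;>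
            simp [ins, Finset.mem_symmDiff] <;> grind
    · push Not at hall
      obtain ⟨z, hz, hzCD⟩ := hall
      obtain ⟨hT, hR⟩ := h.step hz
      have hcard : (A.erase z).card = m := by rw [Finset.card_erase_of_mem hz]; omega
      obtain ⟨b, hb⟩ : ∃ b, b = decide (z ∈ C) := ⟨_, rfl⟩
      have hzD : z ∈ C ↔ z ∈ D := by simp only [Finset.mem_symmDiff] at hzCD; tauto
      have hCb : ins b z (C.erase z) = C := by
        subst hb; ext a; by_cases hs : z ∈ C <;> simp [ins, hs] <;> grind
      have hDb : ins b z (D.erase z) = D := by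
        subst hb; ext a; by_cases hs : z ∈ C <;> simp [ins, hs] <;> grind
      have hC' : C.erase z ∈ tr z F := Finset.mem_image_of_mem _ hC
      have hD' : D.erase z ∈ tr z F := Finset.mem_image_of_mem _ hD
      have hzC' : z ∉ C.erase z := by simp
      have hzD' : z ∉ D.erase z := by simp
      have hne' : C.erase z ≠ D.erase z := by
        intro hh; apply hne; rw [← hCb, ← hDb, hh]
      have hss : ∀ a, a ∈ symmDiff (C.erase z) (D.erase z) → a ∈ symmDiff C D := by
        intro a ha; simp only [Finset.mem_symmDiff, Finset.mem_erase] at *; grind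
      have hlift : ∀ x, x ≠ z → ins b z (symmDiff (C.erase z) {x}) = symmDiff C {x} := by
        intro x hx
        subst hb; ext a
        by_cases hs : z ∈ C <;> simp [ins, hs, Finset.mem_symmDiff] <;> grind
      generalize C.erase z = C' at *
      generalize D.erase z = D' at *
      have key : ∀ (r : ℕ) (E : Finset α), (symmDiff E D').card = r → z ∉ E → ins (!b) z E ∈ F →
          ∃ G ∈ rd z F, symmDiff E G ⊆ symmDiff E D' := by
        intro r
        induction r with
        | zero =>
          intro E hE hzE hEF
          have : E = D' := by simpa using hE
          subst this
          refine ⟨E, mem_rd.2 ⟨hzE, ?_⟩, Finset.Subset.refl _⟩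
          intro c
          by_cases hc : c = b
          · rw [hc, hDb]; exact hD
          · rw [Bool.eq_not_of_ne hc]; exact hEF
        | succ r ihr =>
          intro E hE hzE hEF
          by_cases hER : E ∈ rd z F
          · exact ⟨E, hER, by simp⟩
          have hEt : E ∈ tr z F := mem_tr.2 ⟨hzE, _, hEF⟩
          have hED : E ≠ D' := by rintro rfl; simp at hE
          obtain ⟨x, hx, hxF⟩ := ih hT hcard hEt hD' hED
          have hxA : x ∈ A.erase z := by
            have := hT.sub _ hEt; have := hT.sub _ hD'
            simp only [Finset.mem_symmDiff] at hx; grind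
          rw [Finset.mem_erase] at hxA
          obtain ⟨c, hc1, hc2⟩ := h.edge hz hxA.2 hxA.1 hEt hxF
          have hcb : c = !b := by
            by_contra hcb
            have hcb : c = b := by simpa using Bool.eq_not_of_ne hcb
            apply hER
            refine mem_rd.2 ⟨hzE, fun e => ?_⟩
            by_cases he : e = b
            · rw [he, ← hcb]; exact hc1
            · rw [Bool.eq_not_of_ne he]; exact hEF
          subst hcb
          have heq : symmDiff (symmDiff E {x}) D' = (symmDiff E D').erase x := by
            ext a; simp only [Finset.mem_symmDiff, Finset.mem_erase, Finset.mem_singleton] at *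
            grind
          obtain ⟨G, hG, hGs⟩ := ihr (symmDiff E {x})
            (by rw [heq, Finset.card_erase_of_mem hx]; omega) (mem_tr.1 hxF).1 hc2
          exact ⟨G, hG, (between_aux hx hGs).1⟩
      obtain ⟨x, hx, hxF⟩ := ih hT hcard hC' hD' hne'
      have hxA : x ∈ A.erase z := by
        have := hT.sub _ hC'; have := hT.sub _ hD'
        simp only [Finset.mem_symmDiff] at hx; grind
      rw [Finset.mem_erase] at hxA
      obtain ⟨c, hc1, hc2⟩ := h.edge hz hxA.2 hxA.1 hC' hxF
      by_cases hcb : c = b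
      · subst hcb
        exact ⟨x, hss x hx, by rw [← hlift x hxA.1]; exact hc2⟩
      · have hcb := Bool.eq_not_of_ne hcb
        subst hcb
        obtain ⟨G, hG, hGs⟩ := key _ _ rfl (mem_tr.1 hxF).1 hc2
        have hCR : C' ∈ rd z F := by
          refine mem_rd.2 ⟨hzC', fun e => ?_⟩
          by_cases he : e = b
          · rw [he, hCb]; exact hC
          · rw [Bool.eq_not_of_ne he]; exact hc1
        have hGx : x ∈ symmDiff C' G := (between_aux hx hGs).2
        have hGne : C' ≠ G := by rintro rfl; simp at hGx
        obtain ⟨y, hy, hyF⟩ := ih hR hcard hCR hG hGne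
        have hyD : y ∈ symmDiff C' D' := (between_aux hx hGs).1 hy
        have hyz : y ≠ z := by
          rintro rfl
          simp only [Finset.mem_symmDiff] at hyD
          tauto
        refine ⟨y, hss y hyD, ?_⟩
        rw [← hlift y hyz]
        exact (mem_rd.1 hyF).2 b

theorem bn_lt_two_pow {m k : ℕ} (h : k ≤ m) : bn m k < 2 ^ m := by
  rw [← Nat.sum_range_choose]
  apply Finset.sum_lt_sum_of_subset (i := m)
  · intro a ha; simp at *; omega
  · simp
  · simp; omega
  · simp
  · simp

theorem maximum_stable_small (𝒞 : Set (Set α)) (d n : ℕ)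
    (hmax : isMaximum 𝒞 d) (hLD : ¬ hasLadder 𝒞 (n + 1)) (h0 : (∅ : Set α) ∈ 𝒞) :
    ∀ C ∈ 𝒞, C.encard ≤ (n : ℕ∞) := by
  classical
  intro C hC
  by_contra hcon
  apply hLD
  have hle : ((n + 1 : ℕ) : ℕ∞) ≤ C.encard := by
    rw [not_le] at hcon
    push_cast
    exact Order.add_one_le_of_lt hcon
  obtain ⟨A', hA'C, hA'⟩ := Set.exists_subset_encard_eq hle
  have hfin : A'.Finite := Set.finite_of_encard_eq_coe hA'
  obtain ⟨A, rfl⟩ := hfin.exists_finset_coe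
  have hA : A.card = n + 1 := by
    rw [Set.encard_coe_eq_coe_finsetCard] at hA'
    exact_mod_cast hA'
  -- card of traces on finsets
  have htr : ∀ B : Finset α,
      (B.powerset.filter (fun S : Finset α => ∃ C ∈ 𝒞, (S : Set α) = C ∩ B)).card = bn B.card (d+1) := by
    intro B
    have h1 := hmax B B.finite_toSet
    rw [Set.ncard_coe_finset] at h1
    change _ = bn B.card (d+1) at h1
    rw [← h1, ← Set.ncard_coe_finset, ← Set.ncard_image_of_injective _ Finset.coe_injective]
    congr 1
    ext s
    simp only [trace, Set.mem_image, Finset.coe_filter, Set.mem_setOf_eq, Finset.mem_powerset]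
    constructor
    · rintro ⟨S, ⟨_, C, hC, h⟩, rfl⟩
      exact ⟨C, hC, h⟩
    · rintro ⟨C, hC, rfl⟩
      refine ⟨B.filter (· ∈ C), ⟨Finset.filter_subset _ _, C, hC, ?_⟩, ?_⟩ <;>
      · ext a; simp [and_comm]
  obtain ⟨F, hF⟩ : ∃ F, F = A.powerset.filter (fun S : Finset α => ∃ C ∈ 𝒞, (S : Set α) = C ∩ A) := ⟨_, rfl⟩
  have hmem : ∀ S, S ∈ F ↔ S ⊆ A ∧ ∃ C ∈ 𝒞, (S : Set α) = C ∩ A := by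
    intro S; rw [hF]; simp
  have hM : Mx F A (d+1) := by
    refine ⟨fun S hS => ((hmem S).1 hS).1, by rw [hF, htr], ?_⟩
    intro s hs
    by_contra hlt
    have h1 := bn_lt_two_pow (not_lt.1 hlt)
    rw [← htr s, Finset.filter_true_of_mem, Finset.card_powerset] at h1
    · exact lt_irrefl _ h1
    · intro t ht
      have hsA : s ⊆ A := by
        obtain ⟨u, hu, hsu⟩ := hs (Finset.Subset.refl s)
        exact (Finset.inter_eq_left.1 hsu).trans ((hmem u).1 hu).1
      obtain ⟨u, hu, hsu⟩ := hs (Finset.mem_powerset.1 ht)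
      obtain ⟨_, C, hC, huC⟩ := (hmem u).1 hu
      refine ⟨C, hC, ?_⟩
      rw [← hsu]
      push_cast
      rw [huC]
      ext a
      have := @hsA a
      simp only [Set.mem_inter_iff, Finset.mem_coe]
      tauto
  have hF0 : ∅ ∈ F := (hmem _).2 ⟨by simp, ∅, h0, by simp⟩
  have hFA : A ∈ F := (hmem _).2 ⟨by simp, C, hC, (Set.inter_eq_right.2 hA'C).symm⟩
  have hnb : ∀ D : Finset α, ∃ x, D ∈ F → D ≠ A → x ∉ D ∧ insert x D ∈ F := by
    intro D
    by_cases hD : D ∈ F ∧ D ≠ A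
    · obtain ⟨x, hx, hxF⟩ := Mx.nbr _ hM rfl hD.1 hFA hD.2
      have hDA := hM.sub D hD.1
      have hxD : x ∉ D := by
        simp only [Finset.mem_symmDiff] at hx; grind
      refine ⟨x, fun _ _ => ⟨hxD, ?_⟩⟩
      convert hxF using 1
      ext a
      simp only [Finset.mem_symmDiff, Finset.mem_insert, Finset.mem_singleton]
      grind
    · have : ∃ z, z ∈ A := by apply Finset.card_pos.1; omega
      exact ⟨this.choose, fun h1 h2 => absurd ⟨h1, h2⟩ hD⟩
  choose g hg using hnb
  let S : ℕ → Finset α := fun j => Nat.rec ∅ (fun _ T => insert (g T) T) j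
  have hS0 : S 0 = ∅ := rfl
  have hSs : ∀ j, S (j+1) = insert (g (S j)) (S j) := fun j => rfl
  have hSF : ∀ j, j ≤ n + 1 → S j ∈ F ∧ (S j).card = j := by
    intro j
    induction j with
    | zero => intro _; simp [hS0, hF0]
    | succ j ih =>
      intro hj
      obtain ⟨h1, h2⟩ := ih (by omega)
      have h3 := hg (S j) h1 (by intro hh; rw [hh] at h2; omega)
      rw [hSs, Finset.card_insert_of_notMem h3.1]
      exact ⟨h3.2, by omega⟩
  have hgn : ∀ j, j ≤ n → g (S j) ∉ S j := by
    intro j hj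
    obtain ⟨h1, h2⟩ := hSF j (by omega)
    exact (hg (S j) h1 (by intro hh; rw [hh] at h2; omega)).1
  have hmono : Monotone S := monotone_nat_of_le_succ fun j => by
    rw [hSs]; exact Finset.subset_insert _ _
  have hB := fun j : Fin (n+1) =>
    ((hmem _).1 (hSF j (by omega)).1).2
  choose B hBC hBS using hB
  refine ⟨fun i => g (S i), B, hBC, fun i j => ?_⟩
  have hgA : g (S i) ∈ A := by
    apply hM.sub _ (hSF (i+1) (by omega)).1
    rw [hSs]; simp
  have hiff : g (S i) ∈ B j ↔ g (S i) ∈ S j := by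
    have := congrArg (g (S i) ∈ ·) (hBS j)
    simp only [Finset.mem_coe, Set.mem_inter_iff, hgA, and_true, eq_iff_iff] at this
    exact this.symm
  rw [hiff]
  constructor
  · intro h
    by_contra hij
    exact hgn i (by omega) (hmono (by simpa using hij : (j : ℕ) ≤ i) h)
  · intro h
    apply hmono (show (i : ℕ) + 1 ≤ j from h)
    rw [hSs]; simp
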